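/- Let d = 3 and suppose q = (q̄, q_n(q̄)) is a normalized central configuration satisfying the normalization y_{n−1} = z_{n−1} = z_{n−2} = 0. If x_{n−1} = x_n or x_{n−1} = 0, then q is a degenerate solution of the reduced system RS, i.e. the Jacobian matrix D RS at the corresponding point is singular (its rank is strictly less than 3n − 6). -/

import Mathlib

open scoped BigOperators

noncomputable section

/-- Points in `ℝ^d`, with the Euclidean norm. -/
abbrev Pt (d : ℕ) := EuclideanSpace ℝ (Fin d)

/-- `F_i(q) = −q_i + Σ_{j ≠ i} m_j (q_j − q_i)/‖q_j − q_i‖³`. -/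
noncomputable def nbodyF {d n : ℕ} (m : Fin n → ℝ) (q : Fin n → Pt d) : Fin n → Pt d :=
  fun i => -q i + ∑ j ∈ Finset.univ.erase i, (m j / ‖q j - q i‖ ^ 3) • (q j - q i)

/-- A configuration is collision-free if all bodies occupy distinct positions. -/
def CollisionFree {d n : ℕ} (q : Fin n → Pt d) : Prop :=
  ∀ i j, i ≠ j → q i ≠ q j

/-- A normalized central configuration: collision-free, center of mass at the origin,
and `F(q) = 0`. -/
def IsNCC {d n : ℕ} (m : Fin n → ℝ) (q : Fin n → Pt d) : Prop :=
  CollisionFree q ∧ (∑ i, m i • q i) = 0 ∧ nbodyF m q = 0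

/-- Embedding of the reduced index set `{1,…,n−1}` into `{1,…,n}`. -/
def emb {n : ℕ} (i : Fin (n - 1)) : Fin n := Fin.castLE (Nat.sub_le n 1) i

/-- Extend a reduced configuration `q̄ = (q_1,…,q_{n−1})` by the position of the last body,
`q_n(q̄) = −(1/m_n) Σ_{i<n} m_i q_i`, computed from the center of mass condition. -/
noncomputable def extendConfig {d n : ℕ} (m : Fin n → ℝ) (qbar : Fin (n - 1) → Pt d) :
    Fin n → Pt d :=
  fun i => if h : (i : ℕ) < n - 1 then qbar ⟨i, h⟩
    else (-(1 / m i)) • ∑ j : Fin (n - 1), m (emb j) • qbar j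

/-- The center-of-mass reduced map `F^red_i(q̄) = F_i(q_1,…,q_{n−1},q_n(q̄))`, `i = 1,…,n−1`. -/
noncomputable def Fred {d n : ℕ} (m : Fin n → ℝ) (qbar : Fin (n - 1) → Pt d) :
    Fin (n - 1) → Pt d :=
  fun i => nbodyF m (extendConfig m qbar) (emb i)

/-- The Jacobian matrix of `F`, rows and columns indexed by (body, coordinate). -/
noncomputable def jacF {d n : ℕ} (m : Fin n → ℝ) (q : Fin n → Pt d) :
    Matrix (Fin n × Fin d) (Fin n × Fin d) ℝ :=
  fun p p' =>
    fderiv ℝ (fun q' : Fin n → Pt d => nbodyF m q' p.1 p.2) q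
      (Pi.single p'.1 (EuclideanSpace.single p'.2 (1 : ℝ)))

/-- The Jacobian matrix of `F^red`, rows and columns indexed by (body, coordinate). -/
noncomputable def jacFred {d n : ℕ} (m : Fin n → ℝ) (qbar : Fin (n - 1) → Pt d) :
    Matrix (Fin (n - 1) × Fin d) (Fin (n - 1) × Fin d) ℝ :=
  fun p p' =>
    fderiv ℝ (fun q' : Fin (n - 1) → Pt d => Fred m q' p.1 p.2) qbar
      (Pi.single p'.1 (EuclideanSpace.single p'.2 (1 : ℝ)))

/-- The Jacobian matrix of the spatial reduced system `RS`: it is obtained from `DF^red`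
by removing the rows corresponding to `F^red_{n−1,y}`, `F^red_{n−1,z}`, `F^red_{n−2,z}` and
the columns corresponding to the variables `y_{n−1}`, `z_{n−1}`, `z_{n−2}`
(here `x = 0`, `y = 1`, `z = 2`; the bodies of paper-index `n−1`, `n−2` are `⟨n−2,_⟩`, `⟨n−3,_⟩`). -/
noncomputable def DRS3 {n : ℕ} (hn : 4 ≤ n) (m : Fin n → ℝ) (qbar : Fin (n - 1) → Pt 3) :
    Matrix
      {p : Fin (n - 1) × Fin 3 //
        p ≠ (⟨n - 2, by omega⟩, 1) ∧ p ≠ (⟨n - 2, by omega⟩, 2) ∧ p ≠ (⟨n - 3, by omega⟩, 2)}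
      {p : Fin (n - 1) × Fin 3 //
        p ≠ (⟨n - 2, by omega⟩, 1) ∧ p ≠ (⟨n - 2, by omega⟩, 2) ∧ p ≠ (⟨n - 3, by omega⟩, 2)} ℝ :=
  (jacFred m qbar).submatrix Subtype.val Subtype.val

/-- A square matrix restricted to an index set is rank-deficient if the full matrix kills a nonzero
vector supported on that set. -/
theorem rank_submatrix_lt_of_mulVec_eq_zero {ι : Type*} [Fintype ι] (A : Matrix ι ι ℝ)
    (P : ι → Prop) [Fintype {p // P p}] (w : ι → ℝ) (hP : ∀ p, ¬ P p → w p = 0) (hw : w ≠ 0)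
    (h : A.mulVec w = 0) :
    (A.submatrix (Subtype.val : {p // P p} → ι) (Subtype.val : {p // P p} → ι)).rank
      < Fintype.card {p // P p} := by
  classical
  set M := A.submatrix (Subtype.val : {p // P p} → ι) (Subtype.val : {p // P p} → ι) with hM
  have hker : (fun p : {p // P p} => w p) ∈ LinearMap.ker M.mulVecLin := by
    rw [LinearMap.mem_ker, Matrix.mulVecLin_apply]
    funext i
    have hi := congrFun h i
    simp only [Matrix.mulVec, dotProduct, Pi.zero_apply] at hi
    rw [← Finset.sum_filter_of_ne (p := P)
      (fun x _ hx => by_contra fun hn => hx (by rw [hP x hn, mul_zero]))] at hi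
    rw [Finset.sum_subtype (p := P) _ (by simp)] at hi
    simpa [Matrix.mulVec, dotProduct, hM] using hi
  have hne : (fun p : {p // P p} => w p) ≠ 0 := by
    intro h0
    apply hw
    funext p
    by_cases hp : P p
    · exact congrFun h0 ⟨p, hp⟩
    · exact hP p hp
  have hpos : 0 < Module.finrank ℝ (LinearMap.ker M.mulVecLin) := by
    rw [Module.finrank_pos_iff_exists_ne_zero]
    exact ⟨⟨_, hker⟩, fun h0 => hne (congrArg Subtype.val h0)⟩
  have hrn := LinearMap.finrank_range_add_finrank_ker M.mulVecLin
  rw [Module.finrank_fintype_fun_eq_card] at hrn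
  rw [Matrix.rank]
  omega

/-- The transposed version of `rank_submatrix_lt_of_mulVec_eq_zero`. -/
theorem rank_submatrix_lt_of_vecMul_eq_zero {ι : Type*} [Fintype ι] (A : Matrix ι ι ℝ)
    (P : ι → Prop) [Fintype {p // P p}] (w : ι → ℝ) (hP : ∀ p, ¬ P p → w p = 0) (hw : w ≠ 0)
    (h : A.vecMul w = 0) :
    (A.submatrix (Subtype.val : {p // P p} → ι) (Subtype.val : {p // P p} → ι)).rank
      < Fintype.card {p // P p} := by
  have := rank_submatrix_lt_of_mulVec_eq_zero A.transpose P w hP hw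
    (by rw [Matrix.mulVec_transpose, h])
  rwa [← Matrix.transpose_submatrix, Matrix.rank_transpose] at this

theorem card_subtype_ne_three {ι : Type*} [Fintype ι] (a b c : ι)
    [Fintype {p // p ≠ a ∧ p ≠ b ∧ p ≠ c}] (hab : a ≠ b) (hac : a ≠ c) (hbc : b ≠ c) :
    Fintype.card {p // p ≠ a ∧ p ≠ b ∧ p ≠ c} = Fintype.card ι - 3 := by
  classical
  rw [Fintype.card_of_subtype (({a, b, c} : Finset ι)ᶜ) (by simp), Finset.card_compl,
    Finset.card_eq_three.mpr ⟨a, b, c, hab, hac, hbc, rfl⟩]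

theorem sum_eq_sum_emb_add {M : Type*} [AddCommMonoid M] {n : ℕ} (hn : 0 < n) (f : Fin n → M) :
    ∑ i, f i = ∑ i : Fin (n - 1), f (emb i) + f ⟨n - 1, by omega⟩ := by
  obtain ⟨k, rfl⟩ : ∃ k, n = k + 1 := ⟨n - 1, by omega⟩
  exact Fin.sum_univ_castSucc f

theorem extendConfig_emb {d n : ℕ} (m : Fin n → ℝ) (q : Fin (n - 1) → Pt d) (i : Fin (n - 1)) :
    extendConfig m q (emb i) = q i := by
  simp [extendConfig, emb]

theorem sum_smul_extendConfig {d n : ℕ} (hn : 0 < n) (m : Fin n → ℝ) (hm : ∀ i, 0 < m i)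
    (q : Fin (n - 1) → Pt d) : ∑ i, m i • extendConfig m q i = 0 := by
  have h := (hm ⟨n - 1, by omega⟩).ne'
  rw [sum_eq_sum_emb_add hn]
  simp only [extendConfig_emb]
  simp [extendConfig, smul_smul, h]

theorem nbodyF_apply {d n : ℕ} (m : Fin n → ℝ) (q : Fin n → Pt d) (i : Fin n) (c : Fin d) :
    nbodyF m q i c = -q i c + ∑ j, m j / ‖q j - q i‖ ^ 3 * (q j c - q i c) := by
  rw [nbodyF, Finset.sum_erase _ (by simp)]
  simp

/-- Conservation of angular momentum about an arbitrary point `o`, in the plane of coordinates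
`a` and `b`, when the center of mass is at the origin. -/
theorem sum_angularMomentum_nbodyF {d n : ℕ} (m : Fin n → ℝ) (q : Fin n → Pt d)
    (hq : ∑ i, m i • q i = 0) (o : Pt d) (a b : Fin d) :
    ∑ i, m i * ((q i a - o a) * nbodyF m q i b - (q i b - o b) * nbodyF m q i a) = 0 := by
  have hc : ∀ c, ∑ i, m i * q i c = 0 := fun c => by
    simpa using congrArg (fun v : Pt d => v c) hq
  set g : Fin n → Fin n → ℝ := fun i j => m i * (m j / ‖q j - q i‖ ^ 3 *
    ((q i a - o a) * (q j b - q i b) - (q i b - o b) * (q j a - q i a))) with hg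
  have hanti : ∀ i j, g i j = -g j i := fun i j => by
    simp only [hg, norm_sub_rev (q j) (q i)]
    ring
  have hpair : ∑ i, ∑ j, g i j = 0 := by
    have h1 : ∑ i, ∑ j, g i j = -∑ i, ∑ j, g i j := by
      conv_lhs => rw [Finset.sum_comm]
      simp only [← Finset.sum_neg_distrib]
      exact Finset.sum_congr rfl fun i _ => Finset.sum_congr rfl fun j _ => hanti j i
    linarith
  have hterm : ∀ i, m i * ((q i a - o a) * nbodyF m q i b - (q i b - o b) * nbodyF m q i a)
      = o a * (m i * q i b) - o b * (m i * q i a) + ∑ j, g i j := fun i => by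
    have : ∑ j, g i j = m i * ((q i a - o a) * ∑ j, m j / ‖q j - q i‖ ^ 3 * (q j b - q i b)
        - (q i b - o b) * ∑ j, m j / ‖q j - q i‖ ^ 3 * (q j a - q i a)) := by
      simp only [Finset.mul_sum, ← Finset.sum_sub_distrib]
      exact Finset.sum_congr rfl fun j _ => by simp only [hg]; ring
    rw [this, nbodyF_apply, nbodyF_apply]
    ring
  rw [Finset.sum_congr rfl fun i _ => hterm i, Finset.sum_add_distrib, hpair,
    Finset.sum_sub_distrib, ← Finset.mul_sum, ← Finset.mul_sum, hc, hc]
  simp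

theorem differentiable_extendConfig {d n : ℕ} (m : Fin n → ℝ) (i : Fin n) :
    Differentiable ℝ (fun q : Fin (n - 1) → Pt d => extendConfig m q i) := by
  unfold extendConfig
  split_ifs <;> fun_prop

theorem differentiableAt_Fred {d n : ℕ} (m : Fin n → ℝ) (q : Fin (n - 1) → Pt d)
    (hq : CollisionFree (extendConfig m q)) (i : Fin (n - 1)) (c : Fin d) :
    DifferentiableAt ℝ (fun q' => Fred m q' i c) q := by
  have hd : ∀ j, DifferentiableAt ℝ (fun q' : Fin (n - 1) → Pt d => extendConfig m q' j) q :=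
    fun j => differentiable_extendConfig m j q
  have hF : DifferentiableAt ℝ (fun q' => Fred m q' i) q := by
    unfold Fred nbodyF
    refine (hd _).neg.add (DifferentiableAt.fun_sum fun j hj => ?_)
    have hne : extendConfig m q j - extendConfig m q (emb i) ≠ 0 :=
      sub_ne_zero.mpr (hq _ _ (Finset.ne_of_mem_erase hj))
    have hsub := (hd j).sub (hd (emb i))
    have hnorm : DifferentiableAt ℝ (fun q' : Fin (n - 1) → Pt d =>
        ‖extendConfig m q' j - extendConfig m q' (emb i)‖ ^ 3) q :=
      (DifferentiableAt.norm ℝ hsub hne).pow 3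
    have hcoef : DifferentiableAt ℝ (fun q' : Fin (n - 1) → Pt d =>
        m j / ‖extendConfig m q' j - extendConfig m q' (emb i)‖ ^ 3) q := by
      simp only [div_eq_mul_inv]
      exact (hnorm.fun_inv (pow_ne_zero _ (norm_ne_zero_iff.mpr hne))).const_mul (m j)
    exact hcoef.fun_smul hsub
  exact differentiableAt_euclidean.mp hF c

theorem extendConfig_map {d n : ℕ} (m : Fin n → ℝ) (q : Fin (n - 1) → Pt d)
    (R : Pt d →ₗ[ℝ] Pt d) (i : Fin n) :
    extendConfig m (fun j => R (q j)) i = R (extendConfig m q i) := by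
  unfold extendConfig
  split_ifs <;> simp [map_sum]

/-- The reduced map is equivariant under linear isometries. -/
theorem Fred_map {d n : ℕ} (m : Fin n → ℝ) (q : Fin (n - 1) → Pt d)
    (R : Pt d →ₗ[ℝ] Pt d) (hR : ∀ v, ‖R v‖ = ‖v‖) (i : Fin (n - 1)) :
    Fred m (fun j => R (q j)) i = R (Fred m q i) := by
  simp [Fred, nbodyF, extendConfig_map, ← map_sub, hR, map_sum]

/-- The rotation of `ℝ³` by the angle `t` about the `z`-axis. -/
def rotZ (t : ℝ) : Pt 3 →ₗ[ℝ] Pt 3 where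
  toFun v := !₂[Real.cos t * v 0 - Real.sin t * v 1, Real.sin t * v 0 + Real.cos t * v 1, v 2]
  map_add' u v := by
    ext c
    fin_cases c <;> simp <;> ring
  map_smul' r v := by
    ext c
    fin_cases c <;> simp <;> ring

theorem norm_rotZ (t : ℝ) (v : Pt 3) : ‖rotZ t v‖ = ‖v‖ := by
  rw [EuclideanSpace.norm_eq, EuclideanSpace.norm_eq]
  congr 1
  simp only [rotZ, LinearMap.coe_mk, AddHom.coe_mk, Fin.sum_univ_three, Real.norm_eq_abs, sq_abs]
  simp
  linear_combination (v 0 ^ 2 + v 1 ^ 2) * Real.sin_sq_add_cos_sq t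

theorem rotZ_zero (v : Pt 3) : rotZ 0 v = v := by
  ext c
  fin_cases c <;> simp [rotZ]

theorem hasDerivAt_rotZ (v : Pt 3) : HasDerivAt (fun t => rotZ t v) !₂[-v 1, v 0, 0] 0 := by
  have hc := Real.hasDerivAt_cos 0
  have hs := Real.hasDerivAt_sin 0
  have hcoord : ∀ c, HasDerivAt (fun t => rotZ t v c) ((!₂[-v 1, v 0, 0] : Pt 3) c) 0 := by
    intro c
    fin_cases c
    · simpa [rotZ] using (hc.mul_const (v 0)).fun_sub (hs.mul_const (v 1))
    · simpa [rotZ] using (hs.mul_const (v 0)).fun_add (hc.mul_const (v 1))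
    · simpa [rotZ] using hasDerivAt_const (0 : ℝ) (v 2)
  rw [hasDerivAt_iff_hasFDerivAt, ← hasFDerivWithinAt_univ, hasFDerivWithinAt_euclidean]
  intro c
  rw [hasFDerivWithinAt_univ]
  have heq : PiLp.proj 2 (fun _ => ℝ) c ∘L
      ContinuousLinearMap.toSpanSingleton ℝ (!₂[-v 1, v 0, 0] : Pt 3)
      = ContinuousLinearMap.toSpanSingleton ℝ ((!₂[-v 1, v 0, 0] : Pt 3) c) := by
    ext
    simp
  exact heq ▸ (hcoord c).hasFDerivAt

/-- Infinitesimal rotations about the `z`-axis lie in the kernel of `D F^red` at a zero. -/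
theorem fderiv_Fred_rotZ {n : ℕ} (m : Fin n → ℝ) (q : Fin (n - 1) → Pt 3)
    (hq : CollisionFree (extendConfig m q)) (hF : ∀ i, Fred m q i = 0)
    (i : Fin (n - 1)) (c : Fin 3) :
    fderiv ℝ (fun q' => Fred m q' i c) q (fun j => !₂[-q j 1, q j 0, 0]) = 0 := by
  have hcurve : HasDerivAt (fun t : ℝ => fun j => rotZ t (q j))
      (fun j => !₂[-q j 1, q j 0, 0]) 0 := hasDerivAt_pi.mpr fun j => hasDerivAt_rotZ (q j)
  have h0 : (fun j => rotZ 0 (q j)) = q := funext fun j => rotZ_zero (q j)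
  have hd := (differentiableAt_Fred m q hq i c).hasFDerivAt
  rw [← h0] at hd
  have hcomp := hd.comp_hasDerivAt (0 : ℝ) hcurve
  have hz : ((fun q' => Fred m q' i c) ∘ fun t : ℝ => fun j => rotZ t (q j)) = fun _ => 0 := by
    funext t
    simp [Fred_map m q _ (norm_rotZ t), hF]
  rw [hz] at hcomp
  rw [h0] at hcomp
  exact hcomp.unique (hasDerivAt_const _ _)

theorem sum_mul_single {ι : Type*} [Fintype ι] [DecidableEq ι] {d : ℕ} (V : ι → Pt d) :
    ∑ p : ι × Fin d, V p.1 p.2 • (Pi.single p.1 (EuclideanSpace.single p.2 (1 : ℝ)) : ι → Pt d)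
      = V := by
  funext i
  ext c
  simp [Fintype.sum_prod_type, Finset.sum_apply, Pi.single_apply, apply_ite]

theorem jacFred_mulVec {d n : ℕ} (m : Fin n → ℝ) (q V : Fin (n - 1) → Pt d)
    (p : Fin (n - 1) × Fin d) :
    (jacFred m q).mulVec (fun p' => V p'.1 p'.2) p
      = fderiv ℝ (fun q' => Fred m q' p.1 p.2) q V := by
  conv_rhs => rw [← sum_mul_single V]
  simp [Matrix.mulVec, dotProduct, jacFred, mul_comm]

/-- Conservation of angular momentum about the last body yields a left null vector of `D F^red`
at a zero. -/
theorem sum_mul_fderiv_Fred {n : ℕ} (hn : 0 < n) (m : Fin n → ℝ) (hm : ∀ i, 0 < m i)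
    (q : Fin (n - 1) → Pt 3) (hq : CollisionFree (extendConfig m q))
    (hF : ∀ i, Fred m q i = 0) (e : Fin (n - 1) → Pt 3) :
    ∑ i, m (emb i) *
      ((q i 0 - extendConfig m q ⟨n - 1, by omega⟩ 0) * fderiv ℝ (fun q' => Fred m q' i 1) q e
      - (q i 1 - extendConfig m q ⟨n - 1, by omega⟩ 1) * fderiv ℝ (fun q' => Fred m q' i 0) q e)
      = 0 := by
  have hid : ∀ q' : Fin (n - 1) → Pt 3, ∑ i, m (emb i) *
      ((q' i 0 - extendConfig m q' ⟨n - 1, by omega⟩ 0) * Fred m q' i 1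
      - (q' i 1 - extendConfig m q' ⟨n - 1, by omega⟩ 1) * Fred m q' i 0) = 0 := fun q' => by
    have := sum_angularMomentum_nbodyF m _ (sum_smul_extendConfig hn m hm q')
      (extendConfig m q' ⟨n - 1, by omega⟩) 0 1
    rw [sum_eq_sum_emb_add hn] at this
    simpa [extendConfig_emb, Fred] using this
  have hr : ∀ i c, HasFDerivAt
      (fun q' : Fin (n - 1) → Pt 3 => q' i c - extendConfig m q' ⟨n - 1, by omega⟩ c) _ q :=
    fun i c => by
      have h := differentiable_extendConfig (d := 3) m ⟨n - 1, by omega⟩ q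
      have hi : DifferentiableAt ℝ (fun q' : Fin (n - 1) → Pt 3 => q' i) q := by fun_prop
      exact ((differentiableAt_euclidean.mp hi c).sub
        (differentiableAt_euclidean.mp h c)).hasFDerivAt
  have hf := fun i c => (differentiableAt_Fred m q hq i c).hasFDerivAt
  have hsum := HasFDerivAt.fun_sum (u := Finset.univ) fun i _ =>
    (((hr i 0).mul (hf i 1)).sub ((hr i 1).mul (hf i 0))).const_mul (m (emb i))
  have hzero := hsum.unique ((hasFDerivAt_const (0 : ℝ) q).congr_of_eventuallyEq
    (Filter.Eventually.of_forall hid))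
  simpa [hF] using congrArg (fun L : (Fin (n - 1) → Pt 3) →L[ℝ] ℝ => L e) hzero

/-- for a spatial nCC with the normalization `y_{n−1} = z_{n−1} = z_{n−2} = 0`,
if `x_{n−1} = x_n` or `x_{n−1} = 0`, then `D RS` is singular, i.e. its rank is `< 3n − 6`. -/
theorem stmt12 {n : ℕ} (hn : 4 ≤ n) (m : Fin n → ℝ) (hm : ∀ i, 0 < m i)
    (qbar : Fin (n - 1) → Pt 3) (hcc : IsNCC m (extendConfig m qbar))
    (hy1 : qbar ⟨n - 2, by omega⟩ 1 = 0) (hz1 : qbar ⟨n - 2, by omega⟩ 2 = 0)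
    (hz2 : qbar ⟨n - 3, by omega⟩ 2 = 0)
    (hx : qbar ⟨n - 2, by omega⟩ 0 = extendConfig m qbar ⟨n - 1, by omega⟩ 0 ∨
      qbar ⟨n - 2, by omega⟩ 0 = 0) :
    (DRS3 hn m qbar).rank < 3 * n - 6 := by
  have hF : ∀ i, Fred m qbar i = 0 := fun i => congrFun hcc.2.2 (emb i)
  have hne : qbar ⟨n - 2, by omega⟩ ≠ qbar ⟨n - 3, by omega⟩ := by
    have := hcc.1 (emb ⟨n - 2, by omega⟩) (emb ⟨n - 3, by omega⟩)
      (by simp only [emb, ne_eq, Fin.ext_iff, Fin.val_castLE]; omega)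
    rwa [extendConfig_emb, extendConfig_emb] at this
  have hcard : 3 * n - 6 = Fintype.card {p : Fin (n - 1) × Fin 3 //
      p ≠ (⟨n - 2, by omega⟩, 1) ∧ p ≠ (⟨n - 2, by omega⟩, 2) ∧ p ≠ (⟨n - 3, by omega⟩, 2)} := by
    rw [card_subtype_ne_three _ _ _ (by simp) (by simp) (by simp; omega)]
    simp
    omega
  rw [hcard, DRS3]
  rcases hx with hx | hx
  · set o := extendConfig m qbar ⟨n - 1, by omega⟩ with ho
    refine rank_submatrix_lt_of_vecMul_eq_zero _ _
      (fun p => m (emb p.1) * ![-(qbar p.1 1 - o 1), qbar p.1 0 - o 0, 0] p.2) ?_ ?_ ?_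
    · intro p hp
      have : p = (⟨n - 2, by omega⟩, 1) ∨ p = (⟨n - 2, by omega⟩, 2) ∨
        p = (⟨n - 3, by omega⟩, 2) := by tauto
      rcases this with rfl | rfl | rfl <;> simp [hx]
    · intro h0
      have h1 : ∀ i, qbar i 0 = o 0 ∧ qbar i 1 = o 1 := fun i => by
        have ha := congrFun h0 (i, 0)
        have hb := congrFun h0 (i, 1)
        simp [(hm (emb i)).ne'] at ha hb
        constructor <;> linarith
      apply hne
      ext c
      fin_cases c
      · exact (h1 _).1.trans (h1 _).1.symm
      · exact (h1 _).2.trans (h1 _).2.symm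
      · exact hz1.trans hz2.symm
    · funext p'
      refine Eq.trans ?_ (sum_mul_fderiv_Fred (by omega) m hm qbar hcc.1 hF
        (Pi.single p'.1 (EuclideanSpace.single p'.2 (1 : ℝ))))
      simp only [Matrix.vecMul, dotProduct, Fintype.sum_prod_type, Fin.sum_univ_three, jacFred]
      refine Finset.sum_congr rfl fun i _ => ?_
      simp
      ring
  · refine rank_submatrix_lt_of_mulVec_eq_zero _ _
      (fun p => (!₂[-qbar p.1 1, qbar p.1 0, 0] : Pt 3) p.2) ?_ ?_ ?_
    · intro p hp
      have : p = (⟨n - 2, by omega⟩, 1) ∨ p = (⟨n - 2, by omega⟩, 2) ∨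
        p = (⟨n - 3, by omega⟩, 2) := by tauto
      rcases this with rfl | rfl | rfl <;> simp [hx]
    · intro h0
      have ha := congrFun h0 (⟨n - 3, by omega⟩, 0)
      have hb := congrFun h0 (⟨n - 3, by omega⟩, 1)
      simp at ha hb
      apply hne
      ext c
      fin_cases c
      · exact hx.trans hb.symm
      · exact hy1.trans ha.symm
      · exact hz1.trans hz2.symm
    · funext p
      rw [jacFred_mulVec m qbar (fun j => !₂[-qbar j 1, qbar j 0, 0])]
      exact fderiv_Fred_rotZ m qbar hcc.1 hF p.1 p.2
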